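/- Let k ⊆ E ⊆ L ⊆ k̄ be fields with [L : E] = p^s for some s ∈ ℕ, where p = char k. Then L/E is pure. -/

import Mathlib

open Polynomial IntermediateField

noncomputable section

variable (Fq : Type) [Field Fq] [Fintype Fq]

/-- A fixed algebraic closure of the rational function field `k = Fq(T)`. -/
abbrev Kbar := AlgebraicClosure (RatFunc Fq)

/-- The Carlitz action of `T`: the `Fq`-linear map `u ↦ T•u + u^q`. -/
def carlitzT : Module.End Fq (Kbar Fq) where
  toFun u := algebraMap (RatFunc Fq) (Kbar Fq) RatFunc.X * u + u ^ Fintype.card Fq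
  map_add' u v := by
    obtain ⟨n, hp, hcard⟩ := FiniteField.card Fq (ringChar Fq)
    haveI : Fact (ringChar Fq).Prime := ⟨hp⟩
    haveI : CharP (Kbar Fq) (ringChar Fq) :=
      charP_of_injective_algebraMap (algebraMap Fq (Kbar Fq)).injective _
    show algebraMap (RatFunc Fq) (Kbar Fq) RatFunc.X * (u + v) + (u + v) ^ Fintype.card Fq =
      (algebraMap (RatFunc Fq) (Kbar Fq) RatFunc.X * u + u ^ Fintype.card Fq) +
        (algebraMap (RatFunc Fq) (Kbar Fq) RatFunc.X * v + v ^ Fintype.card Fq)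
    rw [hcard, add_pow_char_pow]
    ring
  map_smul' c u := by
    simp only [RingHom.id_apply, smul_add, mul_smul_comm, _root_.smul_pow, FiniteField.pow_card]

/-- The Carlitz module: the `Fq`-algebra morphism `Fq[T] → End_{Fq}(k̄)`
determined by `T ↦ (u ↦ T·u + u^q)`. -/
def carlitzHom : Polynomial Fq →ₐ[Fq] Module.End Fq (Kbar Fq) :=
  aeval (carlitzT Fq)

/-- The Carlitz action `C_a(u)`. -/
def carlitz (a : Polynomial Fq) (u : Kbar Fq) : Kbar Fq :=
  carlitzHom Fq a u

/-- `Λ_a = {u ∈ k̄ : C_a(u) = 0}`. -/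
def Lambda (a : Polynomial Fq) : Set (Kbar Fq) := {u | carlitz Fq a u = 0}

/-- The Carlitz torsion `μ(L)` of an intermediate field `L`. -/
def carlitzTorsion (L : IntermediateField (RatFunc Fq) (Kbar Fq)) : Set (Kbar Fq) :=
  {u | u ∈ L ∧ ∃ a : Polynomial Fq, a ≠ 0 ∧ carlitz Fq a u = 0}

/-- `DrinT(L/K) = {u ∈ L : C_m(u) ∈ K for some nonzero m}`. -/
def DrinT (K L : IntermediateField (RatFunc Fq) (Kbar Fq)) : Set (Kbar Fq) :=
  {u | u ∈ L ∧ ∃ m : Polynomial Fq, m ≠ 0 ∧ carlitz Fq m u ∈ K}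

/-- `L/K` is radical: `L = K(X)` for some `X ⊆ DrinT(L/K)`. -/
def IsRadicalC (K L : IntermediateField (RatFunc Fq) (Kbar Fq)) : Prop :=
  ∃ X ⊆ DrinT Fq K L, L = adjoin (RatFunc Fq) ((K : Set (Kbar Fq)) ∪ X)

/-- `L/K` is pure: every root in `L` of some `C_m`, `m` irreducible, lies in `K`. -/
def IsPureC (K L : IntermediateField (RatFunc Fq) (Kbar Fq)) : Prop :=
  ∀ m : Polynomial Fq, Irreducible m → ∀ u ∈ L, carlitz Fq m u = 0 → u ∈ K

/-- `L/K` is separable: every element of `L` is separable over `K`. -/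
def IsSeparableC (K L : IntermediateField (RatFunc Fq) (Kbar Fq)) : Prop :=
  ∀ u ∈ L, IsSeparable K u

/-- `L/K` is cyclotomic coradical: radical, separable and pure. -/
def IsCycloCoradicalC (K L : IntermediateField (RatFunc Fq) (Kbar Fq)) : Prop :=
  IsRadicalC Fq K L ∧ IsSeparableC Fq K L ∧ IsPureC Fq K L


/-- The polynomial `T·X + X^q` of the Carlitz action of `T`. -/
def carlitzPolyT : (RatFunc Fq)[X] :=
  C RatFunc.X * X + X ^ Fintype.card Fq

/-- The polynomial `C_a(X)`. -/
def carlitzPoly (a : Fq[X]) : (RatFunc Fq)[X] :=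
  ∑ i ∈ Finset.range (a.natDegree + 1),
    C (algebraMap Fq (RatFunc Fq) (a.coeff i)) * (carlitzPolyT Fq).comp^[i] X

lemma aeval_carlitzPolyT_iterate (i : ℕ) (u : Kbar Fq) :
    aeval u ((carlitzPolyT Fq).comp^[i] X) = (carlitzT Fq ^ i) u := by
  induction i with
  | zero => simp
  | succ i ih =>
    rw [Function.iterate_succ_apply', aeval_comp, ih, pow_succ', Module.End.mul_apply]
    simp [carlitzPolyT, carlitzT]

lemma aeval_carlitzPoly (a : Fq[X]) (u : Kbar Fq) :
    aeval u (carlitzPoly Fq a) = carlitz Fq a u := by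
  rw [carlitz, carlitzHom, aeval_eq_sum_range (p := a), LinearMap.sum_apply, carlitzPoly,
    map_sum]
  refine Finset.sum_congr rfl fun i _ => ?_
  rw [map_mul, aeval_carlitzPolyT_iterate, aeval_C, LinearMap.smul_apply, Algebra.smul_def,
    ← IsScalarTower.algebraMap_apply]

lemma natDegree_carlitzPolyT_iterate_le (i : ℕ) :
    ((carlitzPolyT Fq).comp^[i] X).natDegree ≤ Fintype.card Fq ^ i := by
  induction i with
  | zero => simp
  | succ i ih =>
    have hT : (carlitzPolyT Fq).natDegree ≤ Fintype.card Fq := by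
      have := Fintype.one_lt_card (α := Fq)
      rw [carlitzPolyT]
      compute_degree!
      omega
    rw [Function.iterate_succ_apply', pow_succ']
    exact natDegree_comp_le.trans (Nat.mul_le_mul hT ih)

lemma natDegree_carlitzPoly_le (a : Fq[X]) :
    (carlitzPoly Fq a).natDegree ≤ Fintype.card Fq ^ a.natDegree := by
  refine natDegree_sum_le_of_forall_le _ _ fun i hi => ?_
  refine (natDegree_C_mul_le _ _).trans ((natDegree_carlitzPolyT_iterate_le Fq i).trans ?_)
  exact Nat.pow_le_pow_right Fintype.card_pos (by simpa [Nat.lt_succ_iff] using hi)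

lemma derivative_carlitzPolyT_iterate (i : ℕ) :
    derivative ((carlitzPolyT Fq).comp^[i] X) = C (RatFunc.X ^ i) := by
  have hq : (Fintype.card Fq : (RatFunc Fq)[X]) = 0 := by
    rw [← map_natCast (algebraMap Fq (RatFunc Fq)[X]), FiniteField.cast_card_eq_zero, map_zero]
  induction i with
  | zero => simp
  | succ i ih =>
    rw [Function.iterate_succ_apply', derivative_comp, ih, carlitzPolyT]
    simp [derivative_X_pow, hq, pow_succ]

lemma derivative_carlitzPoly (a : Fq[X]) :
    derivative (carlitzPoly Fq a) = C (algebraMap Fq[X] (RatFunc Fq) a) := by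
  conv_rhs => rw [a.as_sum_range_C_mul_X_pow]
  rw [carlitzPoly, derivative_sum, map_sum, map_sum]
  refine Finset.sum_congr rfl fun i _ => ?_
  rw [derivative_C_mul, derivative_carlitzPolyT_iterate, ← C_mul,
    map_mul (algebraMap Fq[X] (RatFunc Fq)), map_pow, RatFunc.algebraMap_X]
  rfl

lemma carlitzPoly_ne_zero {a : Fq[X]} (ha : a ≠ 0) : carlitzPoly Fq a ≠ 0 := by
  intro h
  have := derivative_carlitzPoly Fq a
  rw [h, derivative_zero, eq_comm, C_eq_zero] at this
  exact ha ((map_eq_zero_iff _ (RatFunc.algebraMap_injective Fq)).1 this)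

lemma separable_carlitzPoly {a : Fq[X]} (ha : a ≠ 0) : (carlitzPoly Fq a).Separable := by
  rw [separable_def, derivative_carlitzPoly]
  refine isCoprime_one_right.of_isCoprime_of_dvd_right ?_
  refine (isUnit_C.2 (isUnit_iff_ne_zero.2 ?_)).dvd
  exact (map_ne_zero_iff _ (RatFunc.algebraMap_injective Fq)).2 ha

lemma carlitz_mem (F : IntermediateField (RatFunc Fq) (Kbar Fq)) (a : Fq[X]) {u : Kbar Fq}
    (hu : u ∈ F) : carlitz Fq a u ∈ F := by
  rw [← aeval_carlitzPoly]
  exact Algebra.adjoin_le (S := F.toSubalgebra) (Set.singleton_subset_iff.2 hu)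
    (aeval_mem_adjoin_singleton _ _)

lemma carlitz_mul (a b : Fq[X]) (u : Kbar Fq) :
    carlitz Fq (a * b) u = carlitz Fq a (carlitz Fq b u) := by
  simp [carlitz]

lemma carlitz_zero (a : Fq[X]) : carlitz Fq a 0 = 0 := by
  simp [carlitz]

lemma Lambda_eq_rootSet {a : Fq[X]} (ha : a ≠ 0) :
    Lambda Fq a = (carlitzPoly Fq a).rootSet (Kbar Fq) := by
  ext u
  rw [mem_rootSet_of_ne (carlitzPoly_ne_zero Fq ha), aeval_carlitzPoly]
  rfl

lemma finite_Lambda {a : Fq[X]} (ha : a ≠ 0) : (Lambda Fq a).Finite := by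
  rw [Lambda_eq_rootSet Fq ha]
  exact rootSet_finite _ _

lemma ncard_Lambda_le {a : Fq[X]} (ha : a ≠ 0) :
    (Lambda Fq a).ncard ≤ Fintype.card Fq ^ a.natDegree := by
  rw [Lambda_eq_rootSet Fq ha]
  exact (ncard_rootSet_le _ _).trans (natDegree_carlitzPoly_le Fq a)

/-- The orbit map `a ↦ C_a(u)` on polynomials of degree less than `d`. -/
def carlitzOrbit (d : ℕ) (u : Kbar Fq) : degreeLT Fq d →ₗ[Fq] Kbar Fq :=
  (LinearMap.applyₗ u ∘ₗ (carlitzHom Fq).toLinearMap) ∘ₗ (degreeLT Fq d).subtype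

lemma carlitzOrbit_apply (d : ℕ) (u : Kbar Fq) (a : degreeLT Fq d) :
    carlitzOrbit Fq d u a = carlitz Fq a u := rfl

lemma carlitzOrbit_injective {m : Fq[X]} (hm : Irreducible m) {u : Kbar Fq} (hu0 : u ≠ 0)
    (hu : carlitz Fq m u = 0) : Function.Injective (carlitzOrbit Fq m.natDegree u) := by
  rw [injective_iff_map_eq_zero]
  rintro ⟨a, had⟩ ha
  rw [carlitzOrbit_apply] at ha
  by_contra hne
  have ha0 : a ≠ 0 := fun h => hne (Subtype.ext h)
  have hnd : ¬ m ∣ a := fun h => by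
    rw [mem_degreeLT, ← degree_eq_natDegree hm.ne_zero] at had
    exact ha0 (eq_zero_of_dvd_of_degree_lt h had)
  obtain ⟨x, y, hxy⟩ := (hm.coprime_iff_not_dvd).2 hnd
  apply hu0
  have h1 : carlitz Fq (x * m + y * a) u = 0 := by
    have : carlitz Fq (x * m + y * a) u = carlitz Fq (x * m) u + carlitz Fq (y * a) u := by
      simp [carlitz]
    rw [this, carlitz_mul, carlitz_mul, hu]
    simp only [] at ha
    rw [ha, carlitz_zero, carlitz_zero, add_zero]
  rw [hxy] at h1
  simpa [carlitz] using h1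

lemma natCard_degreeLT (d : ℕ) : Nat.card (degreeLT Fq d) = Fintype.card Fq ^ d := by
  rw [Nat.card_congr (degreeLTEquiv Fq d).toEquiv]
  simp

lemma range_carlitzOrbit {m : Fq[X]} (hm : Irreducible m) {u : Kbar Fq} (hu0 : u ≠ 0)
    (hu : carlitz Fq m u = 0) :
    Set.range (carlitzOrbit Fq m.natDegree u) = Lambda Fq m := by
  refine Set.eq_of_subset_of_ncard_le ?_ ?_ (finite_Lambda Fq hm.ne_zero)
  · rintro _ ⟨a, rfl⟩
    rw [carlitzOrbit_apply]
    change carlitz Fq m _ = 0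
    rw [← carlitz_mul, mul_comm, carlitz_mul, hu, carlitz_zero]
  · refine (ncard_Lambda_le Fq hm.ne_zero).trans ?_
    rw [← Nat.card_coe_set_eq, Nat.card_range_of_injective (carlitzOrbit_injective Fq hm hu0 hu),
      natCard_degreeLT]

lemma ncard_Lambda {m : Fq[X]} (hm : Irreducible m) {u : Kbar Fq} (hu0 : u ≠ 0)
    (hu : carlitz Fq m u = 0) : (Lambda Fq m).ncard = Fintype.card Fq ^ m.natDegree := by
  rw [← range_carlitzOrbit Fq hm hu0 hu, ← Nat.card_coe_set_eq,
    Nat.card_range_of_injective (carlitzOrbit_injective Fq hm hu0 hu), natCard_degreeLT]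

lemma adjoin_le_adjoin_of_mem_Lambda (E : IntermediateField (RatFunc Fq) (Kbar Fq)) {m : Fq[X]}
    (hm : Irreducible m) {u w : Kbar Fq} (hu0 : u ≠ 0) (hu : u ∈ Lambda Fq m)
    (hw : w ∈ Lambda Fq m) : E⟮w⟯ ≤ E⟮u⟯ := by
  rw [← range_carlitzOrbit Fq hm hu0 hu] at hw
  obtain ⟨a, rfl⟩ := hw
  rw [adjoin_simple_le_iff, carlitzOrbit_apply]
  exact carlitz_mem Fq (E⟮u⟯.restrictScalars (RatFunc Fq)) a (mem_adjoin_simple_self E u)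

lemma natDegree_minpoly_eq_of_mem_Lambda (E : IntermediateField (RatFunc Fq) (Kbar Fq))
    {m : Fq[X]} (hm : Irreducible m) {u w : Kbar Fq} (hu0 : u ≠ 0) (hu : u ∈ Lambda Fq m)
    (hw0 : w ≠ 0) (hw : w ∈ Lambda Fq m) :
    (minpoly E w).natDegree = (minpoly E u).natDegree := by
  have h : E⟮w⟯ = E⟮u⟯ :=
    le_antisymm (adjoin_le_adjoin_of_mem_Lambda Fq E hm hu0 hu hw)
      (adjoin_le_adjoin_of_mem_Lambda Fq E hm hw0 hw hu)
  rw [← adjoin.finrank (Algebra.IsIntegral.isIntegral w),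
    ← adjoin.finrank (Algebra.IsIntegral.isIntegral u), h]

lemma minpoly_dvd_carlitzPoly (E : IntermediateField (RatFunc Fq) (Kbar Fq)) {m : Fq[X]}
    {u : Kbar Fq} (hu : u ∈ Lambda Fq m) :
    minpoly E u ∣ (carlitzPoly Fq m).map (algebraMap (RatFunc Fq) E) := by
  apply minpoly.dvd
  rw [aeval_map_algebraMap, aeval_carlitzPoly]
  exact hu

lemma natDegree_minpoly_dvd (E : IntermediateField (RatFunc Fq) (Kbar Fq)) {m : Fq[X]}
    (hm : Irreducible m) {u : Kbar Fq} (hu0 : u ≠ 0) (hu : u ∈ Lambda Fq m) :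
    (minpoly E u).natDegree ∣ Fintype.card Fq ^ m.natDegree - 1 := by
  classical
  set S : Finset (Kbar Fq) := (finite_Lambda Fq hm.ne_zero).toFinset.erase 0 with hS
  have hmem : ∀ w, w ∈ S ↔ w ≠ 0 ∧ w ∈ Lambda Fq m := by simp [hS]
  have hcard : S.card = Fintype.card Fq ^ m.natDegree - 1 := by
    rw [hS, Finset.card_erase_of_mem, ← Set.ncard_eq_toFinset_card _ (finite_Lambda Fq hm.ne_zero),
       ncard_Lambda Fq hm hu0 hu]
    simp [Lambda, carlitz_zero]
  rw [← hcard, Finset.card_eq_sum_card_image (minpoly E) S]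
  refine Finset.dvd_sum fun f hf => ?_
  obtain ⟨v, hv, rfl⟩ := Finset.mem_image.1 hf
  rw [hmem] at hv
  have hint : IsIntegral E v := Algebra.IsIntegral.isIntegral v
  have hsep : (minpoly E v).Separable :=
    ((separable_carlitzPoly Fq hm.ne_zero).map).of_dvd (minpoly_dvd_carlitzPoly Fq E hv.2)
  have hfib : S.filter (fun w => minpoly E w = minpoly E v) =
      ((minpoly E v).rootSet (Kbar Fq)).toFinset := by
    ext w
    rw [Finset.mem_filter, hmem, Set.mem_toFinset, mem_rootSet_of_ne (minpoly.ne_zero hint)]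
    constructor
    · rintro ⟨-, h⟩
      rw [← h, minpoly.aeval]
    · intro h
      have hwv : minpoly E w = minpoly E v :=
        (minpoly.eq_of_irreducible_of_monic (minpoly.irreducible hint) h
          (minpoly.monic hint)).symm
      refine ⟨⟨?_, ?_⟩, hwv⟩
      · rintro rfl
        rw [minpoly.zero] at hwv
        have := minpoly.aeval E v
        rw [← hwv, aeval_X] at this
        exact hv.1 this
      · change carlitz Fq m w = 0
        rw [← aeval_carlitzPoly, ← aeval_map_algebraMap E]
        exact aeval_eq_zero_of_dvd_aeval_eq_zero (minpoly_dvd_carlitzPoly Fq E hv.2) h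
  rw [hfib, Set.toFinset_card, card_rootSet_eq_natDegree hsep (IsAlgClosed.splits _),
    natDegree_minpoly_eq_of_mem_Lambda Fq E hm hu0 hu hv.1 hv.2]

/-- If `k ⊆ E ⊆ L ⊆ k̄` with `[L : E] = p^s` for some `s ∈ ℕ`, where
`p = char k`, then `L/E` is pure. -/
theorem isPure_of_p_power_degree (p : ℕ) [Fact p.Prime] [CharP Fq p]
    (E L : IntermediateField (RatFunc Fq) (Kbar Fq)) (hEL : E ≤ L)
    (s : ℕ) (hdeg : Module.finrank E (extendScalars hEL) = p ^ s) :
    IsPureC Fq E L := by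
  intro m hm u huL hu
  by_cases hu0 : u = 0
  · exact hu0 ▸ E.zero_mem
  have h1 := natDegree_minpoly_dvd Fq E hm hu0 hu
  have h2 : (minpoly E u).natDegree ∣ p ^ s := by
    let v : extendScalars hEL := ⟨u, huL⟩
    have hv : minpoly E u = minpoly E v :=
      minpoly.algebraMap_eq (B' := Kbar Fq) (algebraMap (extendScalars hEL) (Kbar Fq)).injective v
    have : FiniteDimensional E (extendScalars hEL) :=
      Module.finite_of_finrank_pos (hdeg ▸ pow_pos (Fact.out : p.Prime).pos s)
    rw [hv, ← hdeg]
    exact minpoly.degree_dvd (Algebra.IsIntegral.isIntegral v)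
  have hpq : p ∣ Fintype.card Fq ^ m.natDegree := by
    refine dvd_pow ?_ hm.natDegree_pos.ne'
    exact (CharP.cast_eq_zero_iff Fq p _).1 (FiniteField.cast_card_eq_zero Fq)
  have hcop : Nat.Coprime (p ^ s) (Fintype.card Fq ^ m.natDegree - 1) := by
    refine Nat.Coprime.pow_left s ?_
    rw [(Fact.out : p.Prime).coprime_iff_not_dvd]
    intro h
    have hpos : 1 ≤ Fintype.card Fq ^ m.natDegree := Nat.one_le_pow _ _ Fintype.card_pos
    have h3 := (Nat.dvd_sub hpq h)
    rw [Nat.sub_sub_self hpos] at h3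
    exact (Fact.out : p.Prime).one_lt.ne' (Nat.dvd_one.1 h3)
  have hdeg1 : (minpoly E u).natDegree = 1 := Nat.eq_one_of_dvd_coprimes hcop h2 h1
  obtain ⟨x, hx⟩ := minpoly.natDegree_eq_one_iff.1 hdeg1
  exact hx ▸ x.2

end
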